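/- Let (F, ω_M, ω_N) be a relative n-plectic structure and let (f, α), (g, β) ∈ Ω^{n−1}_{Ham}(F) be relative Hamiltonian (n−1)-forms with Hamiltonian vector fields (u₁, v₁) and (u₂, v₂). Then the relative hemi-bracket and semi-bracket are related by {(f,α),(g,β)}_h = {(f,α),(g,β)}_s + d ι_{(u₁,v₁)}(g, β), where d is the relative de Rham differential; in particular the two brackets differ by an exact relative form, and d{(f,α),(g,β)}_h = −ι_{([u₁,u₂],[v₁,v₂])}(ω_M, ω_N). -/

import Mathlib

/-!
STATEMENT 16: Let `(F, ω_M, ω_N)` be a relative `n`-plectic structure and let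
`(f, α), (g, β) ∈ Ω^{n−1}_{Ham}(F)` be relative Hamiltonian `(n−1)`-forms with
Hamiltonian vector fields `(u₁, v₁)`, `(u₂, v₂)`.  Then the relative
hemi-bracket `{(f,α),(g,β)}_h = 𝓛_{(u₁,v₁)}(g, β)` and the relative
semi-bracket `{(f,α),(g,β)}_s = (ι_{u₂}ι_{u₁}ω_M, ι_{v₂}ι_{v₁}ω_N)` are
related by
  `{(f,α),(g,β)}_h = {(f,α),(g,β)}_s + d ι_{(u₁,v₁)}(g, β)`
(`d` the relative de Rham differential), so the two brackets differ by an
exact relative form, and moreover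
  `d {(f,α),(g,β)}_h = −ι_{([u₁,u₂],[v₁,v₂])}(ω_M, ω_N)`.

Formalization: abstract Cartan-calculus model of the forms on `M` and `N`;
`RelForm ΩM ΩN k` is `Ω^{k+1}(F)`, so with `n = k + 3` the relative plectic
form lives in `RelForm ΩM ΩN (k+3)` and the Hamiltonian `(n−1)`-forms in
`RelForm ΩM ΩN (k+1)`.  The hypotheses record the standard Cartan-calculus
identities, the pullback compatibilities, closedness and nondegeneracy of
`(ω_M, ω_N)`, and the Hamiltonian conditions. -/

/-- The operations of Cartan calculus on a graded family `Ω` of differential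
forms with vector fields `VF`. -/
structure CartanCalculus (Ω : ℕ → Type*) (VF : Type*) where
  /-- exterior differential -/
  d : ∀ {n : ℕ}, Ω n → Ω (n + 1)
  /-- interior product -/
  iota : ∀ {n : ℕ}, VF → Ω (n + 1) → Ω n
  /-- Lie derivative -/
  lie : ∀ {n : ℕ}, VF → Ω n → Ω n
  /-- Lie bracket of vector fields -/
  bracket : VF → VF → VF

/-- The standard identities of Cartan calculus. -/
structure CartanFacts {Ω : ℕ → Type*} {VF : Type*} [∀ n, AddCommGroup (Ω n)]
    (C : CartanCalculus Ω VF) : Prop where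
  d_d : ∀ {n : ℕ} (ω : Ω n), C.d (C.d ω) = 0
  d_add : ∀ {n : ℕ} (a b : Ω n), C.d (a + b) = C.d a + C.d b
  iota_add : ∀ {n : ℕ} (X : VF) (a b : Ω (n + 1)),
    C.iota X (a + b) = C.iota X a + C.iota X b
  lie_add : ∀ {n : ℕ} (X : VF) (a b : Ω n),
    C.lie X (a + b) = C.lie X a + C.lie X b
  lie_lie : ∀ {n : ℕ} (X Y : VF) (ω : Ω n),
    C.lie X (C.lie Y ω) - C.lie Y (C.lie X ω) = C.lie (C.bracket X Y) ω
  iota_iota : ∀ {n : ℕ} (X Y : VF) (ω : Ω (n + 2)),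
    C.iota X (C.iota Y ω) + C.iota Y (C.iota X ω) = 0
  d_lie : ∀ {n : ℕ} (X : VF) (ω : Ω n), C.d (C.lie X ω) = C.lie X (C.d ω)
  lie_iota : ∀ {n : ℕ} (X Y : VF) (ω : Ω (n + 1)),
    C.lie X (C.iota Y ω) - C.iota Y (C.lie X ω) = C.iota (C.bracket X Y) ω
  cartan : ∀ {n : ℕ} (X : VF) (ω : Ω (n + 1)),
    C.iota X (C.d ω) + C.d (C.iota X ω) = C.lie X ω

/-- The space of relative `(k+1)`-forms `Ω^{k+1}(F) = Ω^k(M) ⊕ Ω^{k+1}(N)`. -/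
abbrev RelForm (ΩM ΩN : ℕ → Type*) (k : ℕ) := ΩM k × ΩN (k + 1)

section

variable {ΩM ΩN : ℕ → Type*} {VM VN : Type*}
variable [∀ n, AddCommGroup (ΩM n)] [∀ n, AddCommGroup (ΩN n)]

/-- Compatibility of the pullback `F^* = pull` and of `F`-relatedness `Rel`
with the Cartan operations. -/
structure PullFacts (CM : CartanCalculus ΩM VM) (CN : CartanCalculus ΩN VN)
    (pull : ∀ {n : ℕ}, ΩN n → ΩM n) (Rel : VM → VN → Prop) : Prop where
  pull_add : ∀ {n : ℕ} (a b : ΩN n), pull (a + b) = pull a + pull b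
  pull_d : ∀ {n : ℕ} (β : ΩN n), CM.d (pull β) = pull (CN.d β)
  pull_iota : ∀ {n : ℕ} {u : VM} {v : VN}, Rel u v →
    ∀ (β : ΩN (n + 1)), CM.iota u (pull β) = pull (CN.iota v β)
  pull_lie : ∀ {n : ℕ} {u : VM} {v : VN}, Rel u v →
    ∀ (β : ΩN n), CM.lie u (pull β) = pull (CN.lie v β)
  rel_bracket : ∀ {u a : VM} {v b : VN}, Rel u v → Rel a b →
    Rel (CM.bracket u a) (CN.bracket v b)

/-- The relative de Rham differential `d(α, β) = (F^*β + dα, −dβ)`. -/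
def relD (CM : CartanCalculus ΩM VM) (CN : CartanCalculus ΩN VN)
    (pull : ∀ {n : ℕ}, ΩN n → ΩM n) {k : ℕ} (ω : RelForm ΩM ΩN k) :
    RelForm ΩM ΩN (k + 1) :=
  (pull ω.2 + CM.d ω.1, - CN.d ω.2)

/-- The relative interior product `ι_{(u,v)}(α, β) = (ι_u α, −ι_v β)`. -/
def relIota (CM : CartanCalculus ΩM VM) (CN : CartanCalculus ΩN VN)
    (u : VM) (v : VN) {k : ℕ} (ω : RelForm ΩM ΩN (k + 1)) : RelForm ΩM ΩN k :=
  (CM.iota u ω.1, - CN.iota v ω.2)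

/-- The relative Lie derivative `𝓛_{(u,v)}(α, β) = (𝓛_u α, 𝓛_v β)`. -/
def relLie (CM : CartanCalculus ΩM VM) (CN : CartanCalculus ΩN VN)
    (u : VM) (v : VN) {k : ℕ} (ω : RelForm ΩM ΩN k) : RelForm ΩM ΩN k :=
  (CM.lie u ω.1, CN.lie v ω.2)

/-- The relative semi-bracket
`{(f,α),(g,β)}_s = (ι_{u₂}ι_{u₁}ω_M, ι_{v₂}ι_{v₁}ω_N)`, where `(u₁,v₁)` and
`(u₂,v₂)` are the Hamiltonian vector fields of the two Hamiltonian forms and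
`(ω_M, ω_N)` is the relative plectic form. -/
def semiBracket (CM : CartanCalculus ΩM VM) (CN : CartanCalculus ΩN VN)
    (u₁ u₂ : VM) (v₁ v₂ : VN) {k : ℕ} (Ω : RelForm ΩM ΩN (k + 2)) :
    RelForm ΩM ΩN k :=
  (CM.iota u₂ (CM.iota u₁ Ω.1), CN.iota v₂ (CN.iota v₁ Ω.2))

theorem map_zero_of_add {A B : Type*} [AddCommGroup A] [AddCommGroup B] {f : A → B}
    (hf : ∀ a b, f (a + b) = f a + f b) : f 0 = 0 :=
  (AddMonoidHom.mk' f hf).map_zero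

theorem map_neg_of_add {A B : Type*} [AddCommGroup A] [AddCommGroup B] {f : A → B}
    (hf : ∀ a b, f (a + b) = f a + f b) (a : A) : f (-a) = -f a :=
  (AddMonoidHom.mk' f hf).map_neg a

/-- The relative de Rham differential commutes with the relative Lie derivative along a related
pair of vector fields. -/
theorem relD_relLie {CM : CartanCalculus ΩM VM} {CN : CartanCalculus ΩN VN}
    {pull : ∀ {n : ℕ}, ΩN n → ΩM n} {Rel : VM → VN → Prop}
    (hM : CartanFacts CM) (hN : CartanFacts CN) (hP : PullFacts CM CN pull Rel)
    {u : VM} {v : VN} (h : Rel u v) {k : ℕ} (ω : RelForm ΩM ΩN k) :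
    relD CM CN pull (relLie CM CN u v ω) = relLie CM CN u v (relD CM CN pull ω) := by
  ext1
  · simp only [relD, relLie]
    rw [hM.lie_add, hP.pull_lie h, hM.d_lie]
  · simp only [relD, relLie]
    rw [map_neg_of_add (hN.lie_add v), hN.d_lie]

/-- The relative Cartan formula. -/
theorem relLie_eq {CM : CartanCalculus ΩM VM} {CN : CartanCalculus ΩN VN}
    {pull : ∀ {n : ℕ}, ΩN n → ΩM n} {Rel : VM → VN → Prop}
    (hM : CartanFacts CM) (hN : CartanFacts CN) (hP : PullFacts CM CN pull Rel)
    {u : VM} {v : VN} (h : Rel u v) {k : ℕ} (ω : RelForm ΩM ΩN (k + 1)) :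
    relLie CM CN u v ω = relIota CM CN u v (relD CM CN pull ω)
      + relD CM CN pull (relIota CM CN u v ω) := by
  ext1
  · simp only [relD, relLie, relIota, Prod.fst_add]
    rw [hM.iota_add, hP.pull_iota h, map_neg_of_add hP.pull_add, ← hM.cartan]
    abel
  · simp only [relD, relLie, relIota, Prod.snd_add]
    rw [map_neg_of_add (hN.iota_add v), map_neg_of_add hN.d_add, ← hN.cartan]
    abel

theorem relD_relD {CM : CartanCalculus ΩM VM} {CN : CartanCalculus ΩN VN}
    {pull : ∀ {n : ℕ}, ΩN n → ΩM n} {Rel : VM → VN → Prop}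
    (hM : CartanFacts CM) (hN : CartanFacts CN) (hP : PullFacts CM CN pull Rel)
    {k : ℕ} (ω : RelForm ΩM ΩN k) :
    relD CM CN pull (relD CM CN pull ω) = 0 := by
  ext1
  · simp only [relD, Prod.fst_zero]
    rw [hM.d_add, hM.d_d, hP.pull_d, map_neg_of_add hP.pull_add]
    abel
  · simp only [relD, Prod.snd_zero]
    rw [map_neg_of_add hN.d_add, hN.d_d, neg_zero, neg_zero]

theorem relD_add {CM : CartanCalculus ΩM VM} {CN : CartanCalculus ΩN VN}
    {pull : ∀ {n : ℕ}, ΩN n → ΩM n} {Rel : VM → VN → Prop}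
    (hM : CartanFacts CM) (hN : CartanFacts CN) (hP : PullFacts CM CN pull Rel)
    {k : ℕ} (a b : RelForm ΩM ΩN k) :
    relD CM CN pull (a + b) = relD CM CN pull a + relD CM CN pull b := by
  ext1
  · simp only [relD, Prod.fst_add, Prod.snd_add]
    rw [hM.d_add, hP.pull_add]
    abel
  · simp only [relD, Prod.snd_add]
    rw [hN.d_add, neg_add]

theorem relIota_add {CM : CartanCalculus ΩM VM} {CN : CartanCalculus ΩN VN}
    (hM : CartanFacts CM) (hN : CartanFacts CN)
    (u : VM) (v : VN) {k : ℕ} (a b : RelForm ΩM ΩN (k + 1)) :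
    relIota CM CN u v (a + b) = relIota CM CN u v a + relIota CM CN u v b := by
  ext1
  · simp only [relIota, Prod.fst_add, hM.iota_add]
  · simp only [relIota, Prod.snd_add, hN.iota_add, neg_add]

theorem relLie_add {CM : CartanCalculus ΩM VM} {CN : CartanCalculus ΩN VN}
    (hM : CartanFacts CM) (hN : CartanFacts CN)
    (u : VM) (v : VN) {k : ℕ} (a b : RelForm ΩM ΩN k) :
    relLie CM CN u v (a + b) = relLie CM CN u v a + relLie CM CN u v b := by
  ext1
  · simp only [relLie, Prod.fst_add, hM.lie_add]
  · simp only [relLie, Prod.snd_add, hN.lie_add]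

theorem relLie_relIota {CM : CartanCalculus ΩM VM} {CN : CartanCalculus ΩN VN}
    (hM : CartanFacts CM) (hN : CartanFacts CN)
    (u a : VM) (v b : VN) {k : ℕ} (ω : RelForm ΩM ΩN (k + 1)) :
    relLie CM CN u v (relIota CM CN a b ω) =
      relIota CM CN (CM.bracket u a) (CN.bracket v b) ω
        + relIota CM CN a b (relLie CM CN u v ω) := by
  ext1
  · simp only [relLie, relIota, Prod.fst_add]
    rw [← hM.lie_iota, sub_add_cancel]
  · simp only [relLie, relIota, Prod.snd_add]
    rw [map_neg_of_add (hN.lie_add v), ← hN.lie_iota]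
    abel

theorem semiBracket_eq_neg_relIota_relIota {CM : CartanCalculus ΩM VM}
    {CN : CartanCalculus ΩN VN} (hM : CartanFacts CM) (hN : CartanFacts CN)
    (u₁ u₂ : VM) (v₁ v₂ : VN) {k : ℕ} (Ω : RelForm ΩM ΩN (k + 2)) :
    semiBracket CM CN u₁ u₂ v₁ v₂ Ω =
      -relIota CM CN u₁ v₁ (relIota CM CN u₂ v₂ Ω) := by
  ext1
  · simp only [semiBracket, relIota, Prod.fst_neg]
    exact eq_neg_of_add_eq_zero_left (hM.iota_iota u₂ u₁ Ω.1)
  · simp only [semiBracket, relIota, Prod.snd_neg]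
    rw [map_neg_of_add (hN.iota_add v₁), neg_neg]
    exact eq_neg_of_add_eq_zero_left (hN.iota_iota v₂ v₁ Ω.2)

/-- A Hamiltonian pair of vector fields preserves the closed relative form. -/
theorem relLie_eq_zero_of_hamiltonian {CM : CartanCalculus ΩM VM} {CN : CartanCalculus ΩN VN}
    {pull : ∀ {n : ℕ}, ΩN n → ΩM n} {Rel : VM → VN → Prop}
    (hM : CartanFacts CM) (hN : CartanFacts CN) (hP : PullFacts CM CN pull Rel)
    {u : VM} {v : VN} (h : Rel u v) {k : ℕ} {Ω : RelForm ΩM ΩN (k + 2)}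
    (hclosed : relD CM CN pull Ω = 0) {fα : RelForm ΩM ΩN k}
    (hham : relD CM CN pull fα = -relIota CM CN u v Ω) :
    relLie CM CN u v Ω = 0 := by
  rw [relLie_eq hM hN hP h, hclosed, map_zero_of_add (relIota_add hM hN u v),
    ← neg_neg (relIota CM CN u v Ω), ← hham, map_neg_of_add (relD_add hM hN hP),
    relD_relD hM hN hP, neg_zero, add_zero]

theorem relative_hemi_bracket_equals_semi_bracket_plus_exact
    [AddCommGroup VM] [AddCommGroup VN]
    (CM : CartanCalculus ΩM VM) (CN : CartanCalculus ΩN VN)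
    (pull : ∀ {n : ℕ}, ΩN n → ΩM n)
    (Rel : VM → VN → Prop)
    (hM : CartanFacts CM) (hN : CartanFacts CN)
    (hP : PullFacts CM CN pull Rel)
    -- the relative `(k+3)`-plectic structure
    {k : ℕ} (Ω : RelForm ΩM ΩN (k + 3))
    (hclosed : relD CM CN pull Ω = 0)
    (hnondeg : ∀ (u : VM) (v : VN), Rel u v →
      relIota CM CN u v Ω = 0 → u = 0 ∧ v = 0)
    -- two relative Hamiltonian `(n−1)`-forms with their Hamiltonian pairs
    (fα gβ : RelForm ΩM ΩN (k + 1))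
    (u₁ u₂ : VM) (v₁ v₂ : VN)
    (h₁ : Rel u₁ v₁) (h₂ : Rel u₂ v₂)
    (hham₁ : relD CM CN pull fα = - relIota CM CN u₁ v₁ Ω)
    (hham₂ : relD CM CN pull gβ = - relIota CM CN u₂ v₂ Ω) :
    -- hemi-bracket = semi-bracket + exact term
    relLie CM CN u₁ v₁ gβ
      = semiBracket CM CN u₁ u₂ v₁ v₂ Ω
        + relD CM CN pull (relIota CM CN u₁ v₁ gβ)
    ∧
    -- consequently the hemi-bracket is Hamiltonian with vector field the
    -- pair bracket `([u₁,u₂],[v₁,v₂])`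
    relD CM CN pull (relLie CM CN u₁ v₁ gβ)
      = - relIota CM CN (CM.bracket u₁ u₂) (CN.bracket v₁ v₂) Ω := by
  constructor
  · rw [relLie_eq hM hN hP h₁, hham₂, map_neg_of_add (relIota_add hM hN u₁ v₁),
      semiBracket_eq_neg_relIota_relIota hM hN]
  · rw [relD_relLie hM hN hP h₁, hham₂, map_neg_of_add (relLie_add hM hN u₁ v₁),
      relLie_relIota hM hN, relLie_eq_zero_of_hamiltonian hM hN hP h₁ hclosed hham₁,
      map_zero_of_add (relIota_add hM hN u₂ v₂), add_zero]

end
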